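/- arXiv:2407.15271 — 3 statements merged into one kernel-verified Lean document; each statement's English description precedes it below -/
import Mathlib

section
/- Let (Ξ,Θ,Γ) be a fuzzy metric space whose t-norm Γ is of H-type and such that lim_{ρ→∞} Θ(u,v,ρ) = 1 for all u,v ∈ Ξ. Let {u_n} be a sequence in Ξ for which there exists ζ ∈ Π such that Θ(u_{n+2}, u_{n+1}, ζ(ρ)) ≥ Θ(u_{n+1}, u_n, ρ) for all n ∈ ℕ and all ρ > 0. Then {u_n} is a G-Cauchy sequence. -/
open Filter Topology

/-- A fuzzy metric space in the sense of George and Veeramani: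
`Θ : Ξ × Ξ × (0,∞) → (0,1]` together with a continuous t-norm `Γ` on `[0,1]`. -/
structure FuzzyMetricSpace (Ξ : Type*) where
  Θ : Ξ → Ξ → ℝ → ℝ
  Γ : ℝ → ℝ → ℝ
  Γ_comm : ∀ a b, Γ a b = Γ b a
  Γ_assoc : ∀ a b c, Γ (Γ a b) c = Γ a (Γ b c)
  Γ_mono : ∀ a ∈ Set.Icc (0:ℝ) 1, ∀ b ∈ Set.Icc (0:ℝ) 1, ∀ c ∈ Set.Icc (0:ℝ) 1,
    b ≤ c → Γ a b ≤ Γ a c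
  Γ_one : ∀ a ∈ Set.Icc (0:ℝ) 1, Γ a 1 = a
  Γ_mem : ∀ a ∈ Set.Icc (0:ℝ) 1, ∀ b ∈ Set.Icc (0:ℝ) 1, Γ a b ∈ Set.Icc (0:ℝ) 1
  Γ_cont : ContinuousOn (fun p : ℝ × ℝ => Γ p.1 p.2) (Set.Icc 0 1 ×ˢ Set.Icc 0 1)
  Θ_pos : ∀ u v ρ, 0 < ρ → 0 < Θ u v ρ
  Θ_le_one : ∀ u v ρ, 0 < ρ → Θ u v ρ ≤ 1
  Θ_eq_one_iff : ∀ u v ρ, 0 < ρ → (Θ u v ρ = 1 ↔ u = v)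
  Θ_symm : ∀ u v ρ, Θ u v ρ = Θ v u ρ
  Θ_tri : ∀ u v z ρ s, 0 < ρ → 0 < s → Γ (Θ u v ρ) (Θ v z s) ≤ Θ u z (ρ + s)
  Θ_cont : ∀ u v, ContinuousOn (Θ u v) (Set.Ioi 0)

variable {Ξ : Type*}

/-- Convergence of a sequence in a fuzzy metric space. -/
def FuzzyMetricSpace.Converges (F : FuzzyMetricSpace Ξ) (u : ℕ → Ξ) (x : Ξ) : Prop :=
  ∀ ε ∈ Set.Ioo (0:ℝ) 1, ∀ ρ > (0:ℝ), ∃ N : ℕ, ∀ n ≥ N, 1 - ε < F.Θ (u n) x ρ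

/-- G-Cauchy sequences in a fuzzy metric space. -/
def FuzzyMetricSpace.GCauchy (F : FuzzyMetricSpace Ξ) (u : ℕ → Ξ) : Prop :=
  ∀ p : ℕ, 0 < p → ∀ ε ∈ Set.Ioo (0:ℝ) 1, ∀ ρ > (0:ℝ),
    ∃ N : ℕ, ∀ n ≥ N, 1 - ε < F.Θ (u n) (u (n + p)) ρ

/-- G-completeness: every G-Cauchy sequence converges. -/
def FuzzyMetricSpace.GComplete (F : FuzzyMetricSpace Ξ) : Prop :=
  ∀ u : ℕ → Ξ, F.GCauchy u → ∃ x : Ξ, F.Converges u x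

/-- Iterates of a t-norm: `Γ^0(a) = 1`, `Γ^{n+1}(a) = Γ(Γ^n(a), a)`. -/
def tnormIter (Γ : ℝ → ℝ → ℝ) : ℕ → ℝ → ℝ
  | 0, _ => 1
  | n + 1, a => Γ (tnormIter Γ n a) a

/-- A t-norm of H-type. -/
def FuzzyMetricSpace.HType (F : FuzzyMetricSpace Ξ) : Prop :=
  ∀ ε ∈ Set.Ioo (0:ℝ) 1, ∃ lam ∈ Set.Ioo (0:ℝ) 1,
    ∀ ρ ∈ Set.Icc (0:ℝ) 1, 1 - lam < ρ → ∀ n : ℕ, 1 ≤ n → 1 - ε < tnormIter F.Γ n ρ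

/-- The class `Π` of functions `ζ : (0,∞) → (0,∞)` whose iterates tend to `0`. -/
def MemPi (ζ : ℝ → ℝ) : Prop :=
  (∀ ρ > (0:ℝ), 0 < ζ ρ) ∧ ∀ ρ > (0:ℝ), Tendsto (fun n : ℕ => ζ^[n] ρ) atTop (nhds 0)

namespace FuzzyMetricSpace

theorem Θ_mem_Icc (F : FuzzyMetricSpace Ξ) (x y : Ξ) {ρ : ℝ} (hρ : 0 < ρ) :
    F.Θ x y ρ ∈ Set.Icc (0 : ℝ) 1 :=
  ⟨(F.Θ_pos x y ρ hρ).le, F.Θ_le_one x y ρ hρ⟩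

theorem Θ_lt_mono (F : FuzzyMetricSpace Ξ) (x y : Ξ) {ρ s : ℝ} (hρ : 0 < ρ) (hs : ρ < s) :
    F.Θ x y ρ ≤ F.Θ x y s := by
  have htri := F.Θ_tri x y y ρ (s - ρ) hρ (sub_pos.2 hs)
  rwa [(F.Θ_eq_one_iff y y (s - ρ) (sub_pos.2 hs)).2 rfl, F.Γ_one _ (F.Θ_mem_Icc x y hρ),
    add_sub_cancel] at htri

theorem tendsto_Γ_one (F : FuzzyMetricSpace Ξ) {α : Type*} {l : Filter α} {f g : α → ℝ}
    (hf : Tendsto f l (𝓝 1)) (hg : Tendsto g l (𝓝 1))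
    (hf' : ∀ a, f a ∈ Set.Icc (0 : ℝ) 1) (hg' : ∀ a, g a ∈ Set.Icc (0 : ℝ) 1) :
    Tendsto (fun a => F.Γ (f a) (g a)) l (𝓝 1) := by
  have h1 : (1 : ℝ) ∈ Set.Icc (0 : ℝ) 1 := ⟨zero_le_one, le_rfl⟩
  have hc : Tendsto (fun p : ℝ × ℝ => F.Γ p.1 p.2)
      (𝓝[Set.Icc 0 1 ×ˢ Set.Icc 0 1] ((1 : ℝ), (1 : ℝ))) (𝓝 (F.Γ 1 1)) :=
    F.Γ_cont (1, 1) ⟨h1, h1⟩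
  rw [F.Γ_one 1 h1] at hc
  exact hc.comp (tendsto_nhdsWithin_iff.2
    ⟨hf.prodMk_nhds hg, Eventually.of_forall fun a => ⟨hf' a, hg' a⟩⟩)

/-- If consecutive terms become arbitrarily close at every scale, then so do terms at any fixed
distance in the index. -/
theorem gCauchy_of_tendsto_succ (F : FuzzyMetricSpace Ξ) {u : ℕ → Ξ}
    (hu : ∀ ρ > (0 : ℝ), Tendsto (fun n => F.Θ (u n) (u (n + 1)) ρ) atTop (𝓝 1)) :
    F.GCauchy u := by
  have key (p : ℕ) : ∀ ρ > (0 : ℝ), Tendsto (fun n => F.Θ (u n) (u (n + p)) ρ) atTop (𝓝 1) := by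
    induction p with
    | zero =>
      intro ρ hρ
      simp [(F.Θ_eq_one_iff _ _ ρ hρ).2 rfl]
    | succ p ih =>
      intro ρ hρ
      have hρ2 := half_pos hρ
      refine tendsto_of_tendsto_of_tendsto_of_le_of_le
        (F.tendsto_Γ_one (ih _ hρ2) ((hu _ hρ2).comp (tendsto_add_atTop_nat p))
          (fun n => F.Θ_mem_Icc _ _ hρ2) (fun n => F.Θ_mem_Icc _ _ hρ2))
        tendsto_const_nhds (fun n => ?_) (fun n => F.Θ_le_one _ _ ρ hρ)
      simpa [add_assoc] using F.Θ_tri (u n) (u (n + p)) (u (n + p + 1)) _ _ hρ2 hρ2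
  intro p _ ε hε ρ hρ
  exact eventually_atTop.1 ((key p ρ hρ).eventually_const_lt (by linarith [hε.1]))

end FuzzyMetricSpace

theorem MemPi.iterate_pos {ζ : ℝ → ℝ} (hζ : MemPi ζ) {ρ : ℝ} (hρ : 0 < ρ) (n : ℕ) :
    0 < ζ^[n] ρ := by
  induction n with
  | zero => exact hρ
  | succ n ih =>
    rw [Function.iterate_succ_apply']
    exact hζ.1 _ ih

/-- Lemma 4 of the paper. -/
theorem gCauchy_of_zeta_contractive_sequence
    {Ξ : Type*} (F : FuzzyMetricSpace Ξ) (hH : F.HType)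
    (hlim : ∀ u v : Ξ, Tendsto (fun ρ => F.Θ u v ρ) atTop (nhds 1))
    (u : ℕ → Ξ) (ζ : ℝ → ℝ) (hζ : MemPi ζ)
    (h : ∀ n : ℕ, ∀ ρ > (0:ℝ), F.Θ (u (n + 1)) (u n) ρ ≤ F.Θ (u (n + 2)) (u (n + 1)) (ζ ρ)) :
    F.GCauchy u := by
  have hiter (s : ℝ) (hs : 0 < s) (n : ℕ) :
      F.Θ (u 1) (u 0) s ≤ F.Θ (u (n + 1)) (u n) (ζ^[n] s) := by
    induction n with
    | zero => exact le_rfl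
    | succ n ih =>
      rw [Function.iterate_succ_apply']
      exact ih.trans (h n _ (hζ.iterate_pos hs n))
  refine F.gCauchy_of_tendsto_succ fun ρ hρ => tendsto_order.2 ⟨fun a ha => ?_, fun a ha =>
    Eventually.of_forall fun n => (F.Θ_le_one _ _ ρ hρ).trans_lt ha⟩
  obtain ⟨s, has, hs⟩ :=
    (((hlim (u 1) (u 0)).eventually_const_lt ha).and (eventually_gt_atTop 0)).exists
  filter_upwards [(hζ.2 s hs).eventually_lt_const hρ] with n hn
  rw [F.Θ_symm]
  exact has.trans_le ((hiter s hs n).trans (F.Θ_lt_mono _ _ (hζ.iterate_pos hs n) hn))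
end

section
/- Let (Ξ,Θ,Γ) be a fuzzy metric space such that lim_{ρ→∞} Θ(u,v,ρ) = 1 for all u,v ∈ Ξ, let ζ ∈ Π, and let z, v ∈ Ξ be points satisfying Θ(z, v, ζ(ρ)) ≥ Θ(z, v, ρ) for all ρ > 0. Then Θ(z, v, ρ) = 1 for all ρ > 0, and hence z = v. -/
open Filter Topology

variable {Ξ : Type*}

/-- In a fuzzy metric space, `Θ u v` is nondecreasing on the positive reals. -/
theorem FuzzyMetricSpace.monotoneOn_theta (F : FuzzyMetricSpace Ξ) (u v : Ξ) :
    MonotoneOn (F.Θ u v) (Set.Ioi 0) := by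
  intro r hr t _ hrt
  rcases hrt.eq_or_lt with rfl | hlt
  · rfl
  · have htri := F.Θ_tri u v v r (t - r) hr (sub_pos.2 hlt)
    rwa [(F.Θ_eq_one_iff v v (t - r) (sub_pos.2 hlt)).2 rfl,
      F.Γ_one _ ⟨(F.Θ_pos u v r hr).le, F.Θ_le_one u v r hr⟩, add_sub_cancel] at htri

/-- If `f (ζ ρ) ≥ f ρ` for all `ρ > 0`, then `f` does not decrease along the iterates of `ζ`. -/
theorem MemPi.iterate_pos_and_le {ζ f : ℝ → ℝ} (hζ : MemPi ζ)
    (h : ∀ ρ > (0:ℝ), f ρ ≤ f (ζ ρ)) {ρ : ℝ} (hρ : 0 < ρ) (n : ℕ) :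
    0 < ζ^[n] ρ ∧ f ρ ≤ f (ζ^[n] ρ) := by
  induction n with
  | zero => exact ⟨hρ, le_rfl⟩
  | succ n ih =>
    rw [Function.iterate_succ_apply']
    exact ⟨hζ.1 _ ih.1, ih.2.trans (h _ ih.1)⟩

/-- the uniqueness argument in the proof of the single-valued theorem. -/
theorem eq_of_theta_zeta_invariant
    {Ξ : Type*} (F : FuzzyMetricSpace Ξ)
    (hlim : ∀ u v : Ξ, Tendsto (fun ρ => F.Θ u v ρ) atTop (nhds 1))
    (ζ : ℝ → ℝ) (hζ : MemPi ζ) (z v : Ξ)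
    (h : ∀ ρ > (0:ℝ), F.Θ z v ρ ≤ F.Θ z v (ζ ρ)) :
    (∀ ρ > (0:ℝ), F.Θ z v ρ = 1) ∧ z = v := by
  have hone : ∀ ρ > (0:ℝ), F.Θ z v ρ = 1 := by
    intro t ht
    refine le_antisymm (F.Θ_le_one z v t ht) (le_of_tendsto (hlim z v) ?_)
    filter_upwards [eventually_gt_atTop (0:ℝ)] with R hR
    obtain ⟨n, hn⟩ := ((hζ.2 R hR).eventually_lt_const ht).exists
    obtain ⟨hpos, hle⟩ := hζ.iterate_pos_and_le h hR n
    exact hle.trans (F.monotoneOn_theta z v hpos ht hn.le)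
  exact ⟨hone, (F.Θ_eq_one_iff z v 1 one_pos).1 (hone 1 one_pos)⟩
end

section
/- Let (Ξ,d) be a metric space and f : Ξ → Ξ a mapping such that: (a) every sequence {ι_n} in Ξ with the property that for each positive integer p, d(ι_n, ι_{n+p}) → 0 as n → ∞, is convergent; and (b) there exists a function ζ : (0,∞) → (0,∞) with ζ^n(ρ) → 0 as n → ∞ for every ρ > 0, such that ρ · d(f ι, f κ) ≤ ζ(ρ) · d(ι, κ) for all ι, κ ∈ Ξ and all ρ > 0. Then f possesses a unique fixed point z ∈ Ξ, and for every ι ∈ Ξ the sequence of iterates {f^n ι} converges to z. -/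
open Filter Topology

lemma iterate_pos_of_pos {ζ : ℝ → ℝ} (hζpos : ∀ ρ > (0:ℝ), 0 < ζ ρ) {ρ : ℝ} (hρ : 0 < ρ) (n : ℕ) :
    0 < ζ^[n] ρ := by
  induction n with
  | zero => exact hρ
  | succ n ih => rw [Function.iterate_succ_apply']; exact hζpos _ ih

lemma mul_dist_iterate_le {Ξ : Type*} [PseudoMetricSpace Ξ] {f : Ξ → Ξ} {ζ : ℝ → ℝ}
    (hζpos : ∀ ρ > (0:ℝ), 0 < ζ ρ)
    (hb : ∀ ι κ : Ξ, ∀ ρ > (0:ℝ), ρ * dist (f ι) (f κ) ≤ ζ ρ * dist ι κ)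
    {ρ : ℝ} (hρ : 0 < ρ) (x y : Ξ) (n : ℕ) :
    ρ * dist (f^[n] x) (f^[n] y) ≤ ζ^[n] ρ * dist x y := by
  induction n with
  | zero => exact le_rfl
  | succ n ih =>
    have hn := iterate_pos_of_pos hζpos hρ n
    simp only [Function.iterate_succ_apply']
    refine le_of_mul_le_mul_left ?_ hn
    calc ζ^[n] ρ * (ρ * dist (f (f^[n] x)) (f (f^[n] y)))
        = ρ * (ζ^[n] ρ * dist (f (f^[n] x)) (f (f^[n] y))) := by ring
      _ ≤ ρ * (ζ (ζ^[n] ρ) * dist (f^[n] x) (f^[n] y)) :=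
          mul_le_mul_of_nonneg_left (hb _ _ _ hn) hρ.le
      _ = ζ (ζ^[n] ρ) * (ρ * dist (f^[n] x) (f^[n] y)) := by ring
      _ ≤ ζ (ζ^[n] ρ) * (ζ^[n] ρ * dist x y) :=
          mul_le_mul_of_nonneg_left ih (hζpos _ hn).le
      _ = ζ^[n] ρ * (ζ (ζ^[n] ρ) * dist x y) := by ring

lemma tendsto_dist_iterate_zero {Ξ : Type*} [PseudoMetricSpace Ξ] {f : Ξ → Ξ} {ζ : ℝ → ℝ}
    (hζpos : ∀ ρ > (0:ℝ), 0 < ζ ρ)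
    (hζ : ∀ ρ > (0:ℝ), Tendsto (fun n : ℕ => ζ^[n] ρ) atTop (nhds 0))
    (hb : ∀ ι κ : Ξ, ∀ ρ > (0:ℝ), ρ * dist (f ι) (f κ) ≤ ζ ρ * dist ι κ) (x y : Ξ) :
    Tendsto (fun n : ℕ => dist (f^[n] x) (f^[n] y)) atTop (nhds 0) := by
  refine squeeze_zero (fun _ => dist_nonneg)
    (fun n => by simpa using mul_dist_iterate_le hζpos hb one_pos x y n) ?_
  simpa using (hζ 1 one_pos).mul_const (dist x y)

/-- relative fixed point result in an ordinary metric space. -/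
theorem metric_zeta_contraction_unique_fixed_point
    {Ξ : Type*} [MetricSpace Ξ] [Nonempty Ξ] (f : Ξ → Ξ)
    (ha : ∀ ι : ℕ → Ξ,
      (∀ p : ℕ, 0 < p → Tendsto (fun n : ℕ => dist (ι n) (ι (n + p))) atTop (nhds 0)) →
      ∃ x : Ξ, Tendsto ι atTop (nhds x))
    (ζ : ℝ → ℝ) (hζpos : ∀ ρ > (0:ℝ), 0 < ζ ρ)
    (hζ : ∀ ρ > (0:ℝ), Tendsto (fun n : ℕ => ζ^[n] ρ) atTop (nhds 0))
    (hb : ∀ ι κ : Ξ, ∀ ρ > (0:ℝ), ρ * dist (f ι) (f κ) ≤ ζ ρ * dist ι κ) :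
    ∃ z : Ξ, f z = z ∧ (∀ v : Ξ, f v = v → v = z) ∧
      ∀ ι : Ξ, Tendsto (fun n : ℕ => f^[n] ι) atTop (nhds z) := by
  have hlim := tendsto_dist_iterate_zero hζpos hζ hb
  have hcont : Continuous f :=
    (LipschitzWith.of_dist_le' (K := ζ 1) fun x y => by
      simpa using hb x y 1 one_pos).continuous
  obtain ⟨x⟩ := ‹Nonempty Ξ›
  obtain ⟨z, hz⟩ := ha (fun n => f^[n] x) fun p _ => by
    simpa only [Function.iterate_add_apply] using hlim x (f^[p] x)
  have hfix : f z = z := isFixedPt_of_tendsto_iterate hz hcont.continuousAt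
  have hall : ∀ y : Ξ, Tendsto (fun n : ℕ => f^[n] y) atTop (nhds z) := fun y => by
    rw [tendsto_iff_dist_tendsto_zero]
    simpa only [Function.iterate_fixed hfix] using hlim y z
  refine ⟨z, hfix, fun v hv => ?_, hall⟩
  have hv' := hall v
  simp only [Function.iterate_fixed hv] at hv'
  exact tendsto_nhds_unique tendsto_const_nhds hv'
end
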